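/- Let n_1,…,n_m ∈ ℝ^n, let Δ = Δ(k⁰) be a Delzant polytope with n+1 ≤ m ≤ n+2 facets, and let b ∈ ℤ^n with b ≠ 0. Assume the map k ↦ Cm(Δ(k)) is continuously differentiable on C_Δ and that for every k ∈ C_Δ the vector Ċm(Δ(k)) := (d/dε)|_{ε=0} Cm(Δ(k + ε(1,…,1))) satisfies ⟨Ċm(Δ(k)), b⟩ = 0. Then (Δ, b) is a mass linear pair. -/

import Mathlib

open MeasureTheory

noncomputable section

/-- Euclidean inner product on ℝⁿ. -/
def dot {n : ℕ} (x y : Fin n → ℝ) : ℝ := ∑ i, x i * y i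

/-- The polytope `Δ(k) = ⋂_j {x : ⟨x, n_j⟩ ≤ k_j}` determined by conormals `N` and
support numbers `k`. -/
def PolyDelta {n m : ℕ} (N : Fin m → Fin n → ℝ) (k : Fin m → ℝ) : Set (Fin n → ℝ) :=
  {x | ∀ j, dot x (N j) ≤ k j}

/-- The facet `F_j(k) = Δ(k) ∩ {x : ⟨x, n_j⟩ = k_j}`. -/
def PolyFacet {n m : ℕ} (N : Fin m → Fin n → ℝ) (k : Fin m → ℝ) (j : Fin m) :
    Set (Fin n → ℝ) :=
  {x ∈ PolyDelta N k | dot x (N j) = k j}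

/-- The chamber of the polytope `Δ(k⁰)`: those `k` for which the combinatorics of the
facets of `Δ(k)` agrees with that of `Δ(k⁰)`. -/
def chamber {n m : ℕ} (N : Fin m → Fin n → ℝ) (k0 : Fin m → ℝ) : Set (Fin m → ℝ) :=
  {k | ∀ J : Finset (Fin m),
    (⋂ j ∈ J, PolyFacet N k j).Nonempty ↔ (⋂ j ∈ J, PolyFacet N k0 j).Nonempty}

/-- Center of mass of a subset of ℝⁿ: `Cm(K) = (∫_K x dx)/(∫_K 1 dx)`. -/
def Cm {n : ℕ} (K : Set (Fin n → ℝ)) : Fin n → ℝ :=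
  (∫ x in K, (1 : ℝ))⁻¹ • ∫ x in K, x

/-- `(Δ(k⁰), b)` is a mass linear pair: `⟨Cm(Δ(k)), b⟩` is an (affine) linear function of
`k` on the chamber of `Δ(k⁰)`. -/
def IsMassLinear {n m : ℕ} (N : Fin m → Fin n → ℝ) (k0 : Fin m → ℝ) (b : Fin n → ℝ) :
    Prop :=
  ∃ (R : Fin m → ℝ) (C : ℝ), ∀ k ∈ chamber N k0,
    dot (Cm (PolyDelta N k)) b = (∑ j, R j * k j) + C

/-- `Δ(k)` is a Delzant polytope: each conormal is a primitive integer vector, exactly `n`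
facets meet at each vertex, and the conormals of the facets through any vertex form a
ℤ-basis of ℤⁿ (an integer matrix of determinant ±1). -/
def IsDelzant {n m : ℕ} (N : Fin m → Fin n → ℝ) (k : Fin m → ℝ) : Prop :=
  (∀ j, ∃ z : Fin n → ℤ, (∀ i, N j i = (z i : ℝ)) ∧ Finset.univ.gcd z = 1) ∧
  ∀ v ∈ Set.extremePoints ℝ (PolyDelta N k),
    ∃ J : Finset (Fin m), J.card = n ∧ (∀ j, j ∈ J ↔ dot v (N j) = k j) ∧
      ∃ e : Fin n → Fin m, (∀ i, e i ∈ J) ∧ Function.Injective e ∧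
        |(Matrix.of fun i i' => N (e i) i').det| = 1

lemma dot_add_l {n : ℕ} (x y z : Fin n → ℝ) : dot (x + y) z = dot x z + dot y z :=
  add_dotProduct x y z

lemma dot_add_r {n : ℕ} (x y z : Fin n → ℝ) : dot x (y + z) = dot x y + dot x z :=
  dotProduct_add x y z

lemma dot_smul_l {n : ℕ} (t : ℝ) (x z : Fin n → ℝ) : dot (t • x) z = t * dot x z :=
  smul_dotProduct t x z

lemma dot_smul_r {n : ℕ} (t : ℝ) (x z : Fin n → ℝ) : dot x (t • z) = t * dot x z :=
  dotProduct_smul t x z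

lemma dot_sum_r {n : ℕ} {ι : Type*} (s : Finset ι) (x : Fin n → ℝ) (f : ι → Fin n → ℝ) :
    dot x (∑ i ∈ s, f i) = ∑ i ∈ s, dot x (f i) :=
  dotProduct_sum x s f

lemma dot_sum_l {n : ℕ} {ι : Type*} (s : Finset ι) (x : Fin n → ℝ) (f : ι → Fin n → ℝ) :
    dot (∑ i ∈ s, f i) x = ∑ i ∈ s, dot (f i) x :=
  sum_dotProduct s f x

lemma dot_zero_l {n : ℕ} (x : Fin n → ℝ) : dot 0 x = 0 := zero_dotProduct x

lemma dot_cont {n : ℕ} (z : Fin n → ℝ) : Continuous (fun x => dot x z) := by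
  unfold dot; fun_prop

lemma abs_lin {n m : ℕ} (U : Set (Fin m → ℝ)) (hUo : IsOpen U)
    (hadd : ∀ x ∈ U, ∀ y ∈ U, x + y ∈ U)
    (hsmul : ∀ t : ℝ, 0 < t → ∀ x ∈ U, t • x ∈ U) (k0 : Fin m → ℝ) (hk0 : k0 ∈ U)
    (T : ((Fin n → ℝ) × ℝ) →ₗ[ℝ] (Fin m → ℝ)) (hT : Function.Injective T) (hm : m ≤ n + 2)
    (β : ((Fin n → ℝ) × ℝ) →ₗ[ℝ] ℝ) (f : (Fin m → ℝ) → ℝ) (hf : DifferentiableOn ℝ f U)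
    (hfT : ∀ k ∈ U, ∀ w, k + T w ∈ U → f (k + T w) = f k + β w)
    (hom : ∀ k ∈ U, ∀ t : ℝ, 0 < t → f (t • k) = t * f k) :
    ∃ L : (Fin m → ℝ) →ₗ[ℝ] ℝ, ∀ k ∈ U, f k = L k := by
  by_cases h : ∃ w, T w ∈ U
  · obtain ⟨w, hw⟩ := h
    have h1 : f (T w) = β w := by
      have e1 := hom _ hw 2 (by norm_num)
      have e2 := hfT _ hw w (hadd _ hw _ hw)
      rw [two_smul] at e1
      linarith
    refine ⟨(fderiv ℝ f (T w)).toLinearMap, fun k hk => ?_⟩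
    have hd : HasFDerivAt f (fderiv ℝ f (T w)) (T w) :=
      ((hf _ hw).differentiableAt (hUo.mem_nhds hw)).hasFDerivAt
    have hl : HasDerivAt (fun ε : ℝ => T w + ε • k) k 0 := by
      simpa using ((hasDerivAt_id (0:ℝ)).smul_const k).const_add (T w)
    have hd' : HasFDerivAt f (fderiv ℝ f (T w)) (T w + (0:ℝ) • k) := by simpa using hd
    have h2 := hd'.comp_hasDerivAt (0:ℝ) hl
    have h3 : HasDerivWithinAt (fun ε : ℝ => β w + ε * f k) (f k) (Set.Ici 0) 0 := by
      simpa using (((hasDerivAt_id (0:ℝ)).mul_const (f k)).const_add (β w)).hasDerivWithinAt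
    have h4 : HasDerivWithinAt (fun ε : ℝ => β w + ε * f k) (fderiv ℝ f (T w) k)
        (Set.Ici 0) 0 := by
      refine h2.hasDerivWithinAt.congr (fun ε hε => ?_) ?_
      · rcases eq_or_lt_of_le (show (0:ℝ) ≤ ε from hε) with h0 | h0
        · subst h0; simp [h1]
        · have hek := hsmul ε h0 k hk
          have := hfT _ hek w (hadd _ hek _ hw)
          simp only [Function.comp_apply]
          rw [add_comm (T w), this, hom k hk ε h0]; ring
      · simp [h1]
    exact (uniqueDiffWithinAt_Ici (0:ℝ)).eq_deriv _ h3 h4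
  · push Not at h
    let S : (((Fin n → ℝ) × ℝ) × ℝ) →ₗ[ℝ] (Fin m → ℝ) :=
      T.coprod (LinearMap.toSpanSingleton ℝ _ k0)
    have hS : ∀ w t, S (w, t) = T w + t • k0 := fun w t => by simp [S]
    have hSi : Function.Injective S := by
      rw [← LinearMap.ker_eq_bot, LinearMap.ker_eq_bot']
      rintro ⟨w, t⟩ hwt
      rw [hS] at hwt
      have ht : t = 0 := by
        by_contra ht
        apply h (-(t⁻¹ • w))
        have : k0 = T (-(t⁻¹ • w)) := by
          have e : t • k0 = - T w := by rw [eq_neg_iff_add_eq_zero, add_comm]; exact hwt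
          rw [map_neg, map_smul, ← smul_neg, ← e, smul_smul, inv_mul_cancel₀ ht, one_smul]
        rw [← this]; exact hk0
      subst ht
      have : w = 0 := hT (by simpa using hwt)
      simp [this]
    have hrank : Module.finrank ℝ (((Fin n → ℝ) × ℝ) × ℝ) = n + 2 := by simp
    have hle := LinearMap.finrank_le_finrank_of_injective hSi
    have hfr : Module.finrank ℝ (((Fin n → ℝ) × ℝ) × ℝ) = Module.finrank ℝ (Fin m → ℝ) := by
      rw [hrank] at *
      simp at *; omega
    let E := LinearMap.linearEquivOfInjective S hSi hfr
    refine ⟨(β.coprod (LinearMap.toSpanSingleton ℝ ℝ (f k0))) ∘ₗ E.symm.toLinearMap,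
      fun k hk => ?_⟩
    obtain ⟨⟨w, t⟩, rfl⟩ := E.surjective k
    have hE : E (w, t) = T w + t • k0 := hS w t
    have ht : 0 < t := by
      by_contra ht
      rcases eq_or_lt_of_le (not_lt.1 ht) with h0 | h0
      · subst h0; apply h w; rw [hE] at hk; simpa using hk
      · apply h w
        have := hadd _ hk _ (hsmul (-t) (by linarith) k0 hk0)
        rw [hE] at this
        simpa [add_assoc] using this
    have hk2 := hk
    rw [hE, add_comm] at hk2
    have := hfT _ (hsmul t ht k0 hk0) w hk2
    simp only [LinearMap.comp_apply, LinearEquiv.coe_coe, LinearEquiv.symm_apply_apply]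
    rw [hE, add_comm, this, hom k0 hk0 t ht]
    simp [add_comm]

lemma Cm_translate {n : ℕ} (K : Set (Fin n → ℝ)) (hK : IsCompact K)
    (hi : (interior K).Nonempty) (a : Fin n → ℝ) (K' : Set (Fin n → ℝ))
    (hK' : (fun x => x + a) ⁻¹' K' = K) : Cm K' = Cm K + a := by
  have mp := measurePreserving_add_right (volume : Measure (Fin n → ℝ)) a
  have emb : MeasurableEmbedding (fun x : Fin n → ℝ => x + a) :=
    (MeasurableEquiv.addRight a).measurableEmbedding
  have e1 := mp.setIntegral_preimage_emb emb (fun _ => (1:ℝ)) K'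
  have e2 := mp.setIntegral_preimage_emb emb (fun x => x) K'
  rw [hK'] at e1 e2
  have hfin : volume K < ⊤ := hK.measure_lt_top
  have hpos : 0 < volume K :=
    (isOpen_interior.measure_pos volume hi).trans_le (measure_mono interior_subset)
  have hv : volume.real K ≠ 0 := (ENNReal.toReal_pos hpos.ne' hfin.ne).ne'
  unfold Cm
  rw [← e1, ← e2, integral_add]
  · simp only [setIntegral_const, smul_eq_mul, mul_one, smul_add, smul_smul]
    rw [inv_mul_cancel₀ hv, one_smul]
  · exact continuous_id.continuousOn.integrableOn_compact hK
  · exact continuous_const.continuousOn.integrableOn_compact hK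

open Pointwise in
lemma Cm_smul {n : ℕ} (K : Set (Fin n → ℝ)) (t : ℝ) (ht : 0 < t) :
    Cm (t • K) = t • Cm K := by
  have e1 := Measure.setIntegral_comp_smul_of_pos (volume : Measure (Fin n → ℝ))
    (fun _ => (1:ℝ)) K ht
  have e2 := Measure.setIntegral_comp_smul_of_pos (volume : Measure (Fin n → ℝ))
    (fun x => x) K ht
  have hp : (t ^ Module.finrank ℝ (Fin n → ℝ)) ≠ 0 := (pow_pos ht _).ne'
  rw [integral_smul] at e2
  unfold Cm
  rw [e1, smul_comm t, e2, smul_smul, smul_eq_mul, mul_inv, inv_inv, mul_right_comm,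
    mul_inv_cancel₀ hp, one_mul]

def Amat {n m : ℕ} (N : Fin m → Fin n → ℝ) (e : Fin n → Fin m) : Matrix (Fin n) (Fin n) ℝ :=
  Matrix.of fun i i' => N (e i) i'

def vtx {n m : ℕ} (N : Fin m → Fin n → ℝ) (e : Fin n → Fin m) :
    (Fin m → ℝ) →ₗ[ℝ] (Fin n → ℝ) :=
  (Matrix.mulVecLin (Amat N e)⁻¹) ∘ₗ (LinearMap.funLeft ℝ ℝ e)

lemma Amat_mulVec {n m : ℕ} (N : Fin m → Fin n → ℝ) (e : Fin n → Fin m) (y : Fin n → ℝ)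
    (i : Fin n) : (Amat N e).mulVec y i = dot y (N (e i)) := by
  unfold dot Matrix.mulVec dotProduct Amat
  simp [mul_comm]

lemma vtx_dot {n m : ℕ} (N : Fin m → Fin n → ℝ) (e : Fin n → Fin m)
    (h : (Amat N e).det ≠ 0) (k : Fin m → ℝ) (i : Fin n) :
    dot (vtx N e k) (N (e i)) = k (e i) := by
  rw [← Amat_mulVec]
  simp [vtx, Matrix.mulVec_mulVec, Matrix.mul_nonsing_inv _ (isUnit_iff_ne_zero.2 h),
    LinearMap.funLeft]

lemma vtx_unique {n m : ℕ} (N : Fin m → Fin n → ℝ) (e : Fin n → Fin m)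
    (h : (Amat N e).det ≠ 0) (k : Fin m → ℝ) (y : Fin n → ℝ)
    (hy : ∀ i, dot y (N (e i)) = k (e i)) : y = vtx N e k := by
  have : (Amat N e).mulVec y = LinearMap.funLeft ℝ ℝ e k := by
    ext i; rw [Amat_mulVec, hy]; rfl
  simp [vtx, ← this, Matrix.mulVec_mulVec, Matrix.nonsing_inv_mul _ (isUnit_iff_ne_zero.2 h)]

def VV {n m : ℕ} (N : Fin m → Fin n → ℝ) (k0 : Fin m → ℝ) : Set (Fin n → Fin m) :=
  {e | (Amat N e).det ≠ 0 ∧ ∀ j, j ∉ Set.range e → dot (vtx N e k0) (N j) < k0 j}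

def UU {n m : ℕ} (N : Fin m → Fin n → ℝ) (k0 : Fin m → ℝ) : Set (Fin m → ℝ) :=
  {k | ∀ e ∈ VV N k0, ∀ j, j ∉ Set.range e → dot (vtx N e k) (N j) < k j}

lemma cone_cover {n m : ℕ} (N : Fin m → Fin n → ℝ) (k0 : Fin m → ℝ)
    (hcpt : IsCompact (PolyDelta N k0)) (hne : (PolyDelta N k0).Nonempty)
    (hD : IsDelzant N k0) (c : Fin n → ℝ) :
    ∃ e ∈ VV N k0, ∃ l : Fin n → ℝ, (∀ i, 0 ≤ l i) ∧ c = ∑ i, l i • N (e i) := by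
  obtain ⟨x0, hx0, hmax0⟩ := hcpt.exists_isMaxOn hne (dot_cont c).continuousOn
  have hmax0 : ∀ y ∈ PolyDelta N k0, dot y c ≤ dot x0 c := fun y hy => hmax0 hy
  let B : Set (Fin n → ℝ) := {x ∈ PolyDelta N k0 | dot x0 c ≤ dot x c}
  have hBc : IsCompact B := hcpt.inter_right (isClosed_le continuous_const (dot_cont c))
  obtain ⟨v, hvB⟩ := hBc.extremePoints_nonempty ⟨x0, hx0, le_rfl⟩
  have hBe : IsExtreme ℝ (PolyDelta N k0) B := by
    refine ⟨fun x hx => hx.1, ?_⟩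
    rintro x hx y hy z hz ⟨p, q, hp, hq, hpq, rfl⟩
    refine ⟨hx, ?_⟩
    have h1 := hz.2
    rw [dot_add_l, dot_smul_l, dot_smul_l] at h1
    have h2 := hmax0 y hy
    obtain rfl : q = 1 - p := by linarith
    nlinarith
  have hv := hBe.extremePoints_subset_extremePoints hvB
  have hvm : ∀ y ∈ PolyDelta N k0, dot y c ≤ dot v c :=
    fun y hy => (hmax0 y hy).trans hvB.1.2
  obtain ⟨J, hJc, hJ, e, heJ, hei, hdet⟩ := hD.2 v hv
  have hdet' : (Amat N e).det ≠ 0 := by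
    intro h0
    rw [show (Matrix.of fun i i' => N (e i) i') = Amat N e from rfl, h0] at hdet
    simp at hdet
  have himg : Finset.univ.image e = J := by
    apply Finset.eq_of_subset_of_card_le
    · intro j hj
      obtain ⟨i, -, rfl⟩ := Finset.mem_image.1 hj
      exact heJ i
    · rw [Finset.card_image_of_injective _ hei]; simp [hJc]
  have hvv : v = vtx N e k0 := vtx_unique N e hdet' k0 v fun i => (hJ _).1 (heJ i)
  have hstrict : ∀ j, j ∉ Set.range e → dot v (N j) < k0 j := by
    intro j hj
    refine lt_of_le_of_ne (hv.1 j) fun h => hj ?_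
    have := (hJ j).2 h
    rw [← himg] at this
    simpa using this
  refine ⟨e, ⟨hdet', hvv ▸ hstrict⟩, Matrix.vecMul c (Amat N e)⁻¹, ?_, ?_⟩
  swap
  · have h1 : Matrix.vecMul (Matrix.vecMul c (Amat N e)⁻¹) (Amat N e) = c := by
      rw [Matrix.vecMul_vecMul, Matrix.nonsing_inv_mul _ (isUnit_iff_ne_zero.2 hdet'),
        Matrix.vecMul_one]
    conv_lhs => rw [← h1]
    rw [Matrix.vecMul_eq_sum]
    rfl
  · intro i
    by_contra hneg
    push Not at hneg
    set d : Fin n → ℝ := (Amat N e)⁻¹.mulVec (Pi.single i 1) with hd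
    have hdN : ∀ i', dot d (N (e i')) = if i' = i then 1 else 0 := by
      intro i'
      rw [← Amat_mulVec, hd, Matrix.mulVec_mulVec,
        Matrix.mul_nonsing_inv _ (isUnit_iff_ne_zero.2 hdet'), Matrix.one_mulVec, Pi.single_apply]
    have hdc : dot d c = Matrix.vecMul c (Amat N e)⁻¹ i := by
      rw [hd]
      change _ ⬝ᵥ _ = _
      rw [dotProduct_comm, Matrix.dotProduct_mulVec, dotProduct_single_one]
    have hev : ∀ᶠ t in nhdsWithin (0:ℝ) (Set.Ioi 0), ∀ j, j ∉ Set.range e →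
        dot v (N j) + t * (- dot d (N j)) < k0 j := by
      apply Filter.Eventually.filter_mono nhdsWithin_le_nhds
      rw [Filter.eventually_all]
      intro j
      by_cases hj : j ∈ Set.range e
      · exact Filter.Eventually.of_forall fun t h => absurd hj h
      · have hc : Continuous fun t : ℝ => dot v (N j) + t * (- dot d (N j)) := by fun_prop
        have := hc.continuousAt (x := 0) |>.eventually_lt (continuousAt_const (y := k0 j))
          (by simpa using hstrict j hj)
        exact this.mono fun t ht _ => ht
    obtain ⟨t, ht, ht0⟩ := (hev.and self_mem_nhdsWithin).exists
    have ht0 : 0 < t := ht0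
    have hmem : v + (-t) • d ∈ PolyDelta N k0 := by
      intro j
      rw [dot_add_l, dot_smul_l]
      by_cases hj : j ∈ Set.range e
      · obtain ⟨i', rfl⟩ := hj
        have := hv.1 (e i')
        rw [hdN]
        split_ifs <;> linarith
      · have := ht j hj
        linarith
    have := hvm _ hmem
    rw [dot_add_l, dot_smul_l, hdc] at this
    nlinarith

lemma vtx_mem {n m : ℕ} (N : Fin m → Fin n → ℝ) (k0 k : Fin m → ℝ) (hk : k ∈ UU N k0)
    (e : Fin n → Fin m) (he : e ∈ VV N k0) : vtx N e k ∈ PolyDelta N k := by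
  intro j
  by_cases hj : j ∈ Set.range e
  · obtain ⟨i, rfl⟩ := hj
    exact (vtx_dot N e he.1 k i).le
  · exact (hk e he j hj).le

lemma face_sub {n m : ℕ} (N : Fin m → Fin n → ℝ) (k0 : Fin m → ℝ)
    (hcov : ∀ c : Fin n → ℝ, ∃ e ∈ VV N k0, ∃ l : Fin n → ℝ, (∀ i, 0 ≤ l i) ∧
      c = ∑ i, l i • N (e i))
    (k : Fin m → ℝ) (hk : k ∈ UU N k0) (I : Finset (Fin m)) :
    (⋂ j ∈ I, PolyFacet N k j).Nonempty ↔ ∃ e ∈ VV N k0, ∀ i ∈ I, i ∈ Set.range e := by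
  constructor
  · rintro ⟨x, hx⟩
    have hx : ∀ j ∈ I, x ∈ PolyFacet N k j := by simpa using hx
    obtain ⟨e, he, l, hl, hc⟩ := hcov (∑ j ∈ I, N j)
    refine ⟨e, he, fun i hi => ?_⟩
    by_contra hie
    have hxD : x ∈ PolyDelta N k := (hx i hi).1
    have h1 : dot x (∑ j ∈ I, N j) = ∑ j ∈ I, k j := by
      rw [dot_sum_r]; exact Finset.sum_congr rfl fun j hj => (hx j hj).2
    have h2 : dot x (∑ j ∈ I, N j) ≤ dot (vtx N e k) (∑ j ∈ I, N j) := by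
      rw [hc, dot_sum_r, dot_sum_r]
      refine Finset.sum_le_sum fun i _ => ?_
      rw [dot_smul_r, dot_smul_r, vtx_dot N e he.1]
      exact mul_le_mul_of_nonneg_left (hxD _) (hl i)
    have h3 : dot (vtx N e k) (∑ j ∈ I, N j) < ∑ j ∈ I, k j := by
      rw [dot_sum_r]
      exact Finset.sum_lt_sum (fun j _ => vtx_mem N k0 k hk e he j) ⟨i, hi, hk e he i hie⟩
    linarith
  · rintro ⟨e, he, hI⟩
    refine ⟨vtx N e k, ?_⟩
    simp only [Set.mem_iInter]
    intro j hj
    refine ⟨vtx_mem N k0 k hk e he, ?_⟩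
    obtain ⟨i, rfl⟩ := hI j hj
    exact vtx_dot N e he.1 k i

lemma chamber_eq {n m : ℕ} (hn : 0 < n) (N : Fin m → Fin n → ℝ) (k0 : Fin m → ℝ)
    (hcov : ∀ c : Fin n → ℝ, ∃ e ∈ VV N k0, ∃ l : Fin n → ℝ, (∀ i, 0 ≤ l i) ∧
      c = ∑ i, l i • N (e i)) : chamber N k0 = UU N k0 := by
  have hk0 : k0 ∈ UU N k0 := fun e he => he.2
  ext k
  constructor
  · intro hk e he j hj
    have h1 : (⋂ j ∈ Finset.univ.image e, PolyFacet N k j).Nonempty :=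
      (hk _).2 ((face_sub N k0 hcov k0 hk0 _).2 ⟨e, he, fun i hi => by simpa using hi⟩)
    obtain ⟨y, hy⟩ := h1
    have hy : ∀ i, y ∈ PolyFacet N k (e i) := by simpa using hy
    have hyv : y = vtx N e k := vtx_unique N e he.1 k y fun i => (hy i).2
    rw [← hyv]
    refine lt_of_le_of_ne ((hy ⟨0, hn⟩).1 j) fun heq => ?_
    have h2 : (⋂ i ∈ insert j (Finset.univ.image e), PolyFacet N k i).Nonempty := by
      refine ⟨y, ?_⟩
      simp only [Set.mem_iInter, Finset.mem_insert, Finset.mem_image]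
      rintro i (rfl | ⟨i', -, rfl⟩)
      · exact ⟨(hy ⟨0, hn⟩).1, heq⟩
      · exact hy i'
    obtain ⟨z, hz⟩ := (hk _).1 h2
    simp only [Set.mem_iInter, Finset.mem_insert, Finset.mem_image] at hz
    have hzv : z = vtx N e k0 := vtx_unique N e he.1 k0 z fun i =>
      (hz (e i) (Or.inr ⟨i, Finset.mem_univ _, rfl⟩)).2
    have := (hz j (Or.inl rfl)).2
    have h3 := he.2 j hj
    rw [hzv] at this
    linarith
  · intro hk J
    rw [face_sub N k0 hcov k hk, face_sub N k0 hcov k0 hk0]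

lemma UU_open {n m : ℕ} (N : Fin m → Fin n → ℝ) (k0 : Fin m → ℝ) : IsOpen (UU N k0) := by
  have : UU N k0 = ⋂ e : Fin n → Fin m, ⋂ j : Fin m,
      {k | e ∈ VV N k0 → j ∉ Set.range e → dot (vtx N e k) (N j) < k j} := by
    ext k
    simp only [UU, Set.mem_setOf_eq, Set.mem_iInter]
    exact ⟨fun h e j he => h e he j, fun h e he j => h e j he⟩
  rw [this]
  refine isOpen_iInter_of_finite fun e => isOpen_iInter_of_finite fun j => ?_
  by_cases he : e ∈ VV N k0
  · by_cases hj : j ∈ Set.range e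
    · simp [hj]
    · simp only [he, hj, not_false_eq_true, forall_const]
      have : Continuous (vtx N e) := LinearMap.continuous_of_finiteDimensional _
      exact isOpen_lt ((dot_cont _).comp this) (continuous_apply j)
  · simp [he]

lemma UU_add {n m : ℕ} (N : Fin m → Fin n → ℝ) (k0 : Fin m → ℝ) :
    ∀ x ∈ UU N k0, ∀ y ∈ UU N k0, x + y ∈ UU N k0 := by
  intro x hx y hy e he j hj
  rw [map_add, dot_add_l]
  exact add_lt_add (hx e he j hj) (hy e he j hj)

lemma UU_smul {n m : ℕ} (N : Fin m → Fin n → ℝ) (k0 : Fin m → ℝ) :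
    ∀ t : ℝ, 0 < t → ∀ x ∈ UU N k0, t • x ∈ UU N k0 := by
  intro t ht x hx e he j hj
  rw [map_smul, dot_smul_l]
  exact mul_lt_mul_of_pos_left (hx e he j hj) ht

lemma UU_translate {n m : ℕ} (N : Fin m → Fin n → ℝ) (k0 k : Fin m → ℝ) (a : Fin n → ℝ)
    (hk : k ∈ UU N k0) : (k + fun j => dot a (N j)) ∈ UU N k0 := by
  intro e he j hj
  have : vtx N e (fun j => dot a (N j)) = a := (vtx_unique N e he.1 _ a fun i => rfl).symm
  rw [map_add, dot_add_l, this]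
  exact add_lt_add_left (hk e he j hj) _

lemma poly_compact {n m : ℕ} (N : Fin m → Fin n → ℝ) (k0 : Fin m → ℝ)
    (hcov : ∀ c : Fin n → ℝ, ∃ e ∈ VV N k0, ∃ l : Fin n → ℝ, (∀ i, 0 ≤ l i) ∧
      c = ∑ i, l i • N (e i)) (k : Fin m → ℝ) : IsCompact (PolyDelta N k) := by
  have hb : ∀ c : Fin n → ℝ, ∃ M, ∀ x ∈ PolyDelta N k, dot x c ≤ M := by
    intro c
    obtain ⟨e, he, l, hl, hc⟩ := hcov c
    refine ⟨∑ i, l i * k (e i), fun x hx => ?_⟩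
    rw [hc, dot_sum_r]
    refine Finset.sum_le_sum fun i _ => ?_
    rw [dot_smul_r]
    exact mul_le_mul_of_nonneg_left (hx _) (hl i)
  choose M hM using hb
  have hcl : IsClosed (PolyDelta N k) := by
    have : PolyDelta N k = ⋂ j, {x | dot x (N j) ≤ k j} := by
      ext x; simp [PolyDelta]
    rw [this]
    exact isClosed_iInter fun j => isClosed_le (dot_cont _) continuous_const
  refine IsCompact.of_isClosed_subset
    (isCompact_Icc (a := fun i : Fin n => - M (Pi.single i (-1)))
      (b := fun i : Fin n => M (Pi.single i 1))) hcl fun x hx => ⟨fun i => ?_, fun i => ?_⟩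
  · have := hM (Pi.single i (-1)) x hx
    have h2 : dot x (Pi.single i (-1)) = - x i := by
      change x ⬝ᵥ _ = _
      rw [dotProduct_single]; ring
    rw [h2] at this
    show - M (Pi.single i (-1)) ≤ x i
    linarith
  · have := hM (Pi.single i 1) x hx
    have h2 : dot x (Pi.single i 1) = x i := by
      change x ⬝ᵥ _ = _
      rw [dotProduct_single]; ring
    rw [h2] at this
    exact this

lemma poly_interior {n m : ℕ} (hm : 0 < m) (N : Fin m → Fin n → ℝ) (k0 : Fin m → ℝ)
    (hcov : ∀ c : Fin n → ℝ, ∃ e ∈ VV N k0, ∃ l : Fin n → ℝ, (∀ i, 0 ≤ l i) ∧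
      c = ∑ i, l i • N (e i)) (k : Fin m → ℝ) (hk : k ∈ UU N k0) :
    (interior (PolyDelta N k)).Nonempty := by
  have h1 : ∀ j : Fin m, ∃ e ∈ VV N k0, j ∉ Set.range e := by
    intro j
    obtain ⟨e, he, l, hl, hc⟩ := hcov (- N j)
    refine ⟨e, he, ?_⟩
    rintro ⟨i, rfl⟩
    have h2 := vtx_dot N e he.1 (Pi.single (e i) 1)
    have h3 : dot (vtx N e (Pi.single (e i) 1)) (- N (e i)) =
        dot (vtx N e (Pi.single (e i) 1)) (∑ i, l i • N (e i)) := by rw [hc]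
    rw [dot_sum_r] at h3
    have h4 : dot (vtx N e (Pi.single (e i) 1)) (- N (e i)) = -1 := by
      have := dot_smul_r (-1) (vtx N e (Pi.single (e i) 1)) (N (e i))
      rw [neg_one_smul, h2] at this
      simpa using this
    have h5 : 0 ≤ ∑ i', dot (vtx N e (Pi.single (e i) 1)) (l i' • N (e i')) := by
      refine Finset.sum_nonneg fun i' _ => ?_
      rw [dot_smul_r, h2, Pi.single_apply]
      have := hl i'
      split_ifs <;> simp [this]
    linarith
  choose e he hje using h1
  have hmp : (0:ℝ) < m := by exact_mod_cast hm
  have hopen : IsOpen {x : Fin n → ℝ | ∀ j, dot x (N j) < k j} := by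
    rw [Set.setOf_forall]
    exact isOpen_iInter_of_finite fun j => isOpen_lt (dot_cont _) continuous_const
  refine ⟨(m:ℝ)⁻¹ • ∑ j, vtx N (e j) k, ?_⟩
  refine interior_maximal (fun x hx j => (hx j).le) hopen ?_
  intro j
  rw [dot_smul_l, dot_sum_l, inv_mul_lt_iff₀ hmp]
  calc ∑ i, dot (vtx N (e i) k) (N j) < ∑ i : Fin m, k j :=
        Finset.sum_lt_sum (fun i _ => vtx_mem N k0 k hk _ (he i) j)
          ⟨j, Finset.mem_univ _, hk _ (he j) j (hje j)⟩
    _ = m * k j := by simp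

open Pointwise in
theorem stmt11 {n m : ℕ} (N : Fin m → Fin n → ℝ) (k0 : Fin m → ℝ)
    (hcpt : IsCompact (PolyDelta N k0)) (hint : (interior (PolyDelta N k0)).Nonempty)
    (hDelzant : IsDelzant N k0) (hm1 : n + 1 ≤ m) (hm2 : m ≤ n + 2)
    (b : Fin n → ℤ) (hb : b ≠ 0)
    (hC1 : ContDiffOn ℝ 1 (fun k => Cm (PolyDelta N k)) (chamber N k0))
    (hdot : ∀ k ∈ chamber N k0,
      dot (deriv (fun ε : ℝ => Cm (PolyDelta N (fun j => k j + ε))) 0)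
        (fun i => (b i : ℝ)) = 0) :
    IsMassLinear N k0 (fun i => (b i : ℝ)) := by
  have hn : 0 < n := by
    rcases Nat.eq_zero_or_pos n with rfl | h
    · exact absurd (Subsingleton.elim b 0) hb
    · exact h
  have hm : 0 < m := by omega
  have hcov := cone_cover N k0 hcpt (hint.mono interior_subset) hDelzant
  have hch := chamber_eq hn N k0 hcov
  rw [hch] at hC1 hdot
  have hUo := UU_open N k0
  have hk0 : k0 ∈ UU N k0 := fun e he => he.2
  set β : Fin n → ℝ := fun i => (b i : ℝ) with hβ
  let f : (Fin m → ℝ) → ℝ := fun k => dot (Cm (PolyDelta N k)) β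
  let dL : (Fin n → ℝ) →L[ℝ] ℝ := LinearMap.toContinuousLinearMap
    { toFun := fun x => dot x β
      map_add' := fun x y => dot_add_l x y β
      map_smul' := fun t x => dot_smul_l t x β }
  have hdL : ∀ x, dL x = dot x β := fun x => rfl
  have hCd : DifferentiableOn ℝ (fun k => Cm (PolyDelta N k)) (UU N k0) :=
    hC1.differentiableOn one_ne_zero
  have hfd : DifferentiableOn ℝ f (UU N k0) :=
    dL.differentiable.comp_differentiableOn hCd
  -- homogeneity
  have hom : ∀ k ∈ UU N k0, ∀ t : ℝ, 0 < t → f (t • k) = t * f k := by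
    intro k _ t ht
    have : PolyDelta N (t • k) = t • PolyDelta N k := by
      ext x
      rw [Set.mem_smul_set_iff_inv_smul_mem₀ ht.ne']
      refine forall_congr' fun j => ?_
      rw [dot_smul_l, inv_mul_le_iff₀ ht]; rfl
    simp only [f]
    rw [this, Cm_smul _ t ht, dot_smul_l]
  -- translation
  have htr : ∀ k ∈ UU N k0, ∀ a : Fin n → ℝ, f (k + fun j => dot a (N j)) = f k + dot a β := by
    intro k hk a
    simp only [f]
    rw [Cm_translate (PolyDelta N k) (poly_compact N k0 hcov k)
      (poly_interior hm N k0 hcov k hk) a, dot_add_l]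
    ext x
    refine forall_congr' fun j => ?_
    rw [dot_add_l]
    simp
  -- invariance along (1,...,1)
  have hone : ∀ k ∈ UU N k0, ∀ s : ℝ, (k + fun _ => s) ∈ UU N k0 → f (k + fun _ => s) = f k := by
    intro k hk s hs
    let A : Set ℝ := {t | (fun j => k j + t) ∈ UU N k0}
    have hAo : IsOpen A := hUo.preimage (by fun_prop)
    have hAc : Convex ℝ A := by
      intro x hx y hy p q hp hq hpq
      rcases eq_or_lt_of_le hp with rfl | hp
      · obtain rfl : q = 1 := by linarith
        simpa using hy
      rcases eq_or_lt_of_le hq with rfl | hq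
      · obtain rfl : p = 1 := by linarith
        simpa using hx
      have := UU_add N k0 _ (UU_smul N k0 p hp _ hx) _ (UU_smul N k0 q hq _ hy)
      show (fun j => k j + (p • x + q • y)) ∈ UU N k0
      convert this using 1
      ext j
      simp only [Pi.add_apply, Pi.smul_apply, smul_eq_mul]
      linear_combination (-(k j)) * hpq
    let c : ℝ → (Fin n → ℝ) := fun t => Cm (PolyDelta N (fun j => k j + t))
    have hcd : ∀ t ∈ A, DifferentiableAt ℝ c t := by
      intro t ht
      have h1 : DifferentiableAt ℝ (fun k => Cm (PolyDelta N k)) (fun j => k j + t) :=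
        (hCd _ ht).differentiableAt (hUo.mem_nhds ht)
      have h2 : DifferentiableAt ℝ (fun t : ℝ => (fun j => k j + t : Fin m → ℝ)) t := by
        fun_prop
      exact DifferentiableAt.comp t h1 h2
    have hgd : ∀ t ∈ A, HasDerivAt (fun t => dL (c t)) 0 t := by
      intro t ht
      have h1 := dL.hasFDerivAt.comp_hasDerivAt t (hcd t ht).hasDerivAt
      have h2 := hdot _ ht
      have h3 := deriv_comp_const_add c t 0
      have h4 : (fun x => c (t + x)) =
          fun ε : ℝ => Cm (PolyDelta N (fun j => (k j + t) + ε)) := by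
        ext1 x; simp only [c, add_assoc]
      rw [h4, add_zero] at h3
      rw [h3] at h2
      rw [hdL, h2] at h1
      exact h1
    have h0 : (0:ℝ) ∈ A := by simpa [A] using hk
    have := hAo.is_const_of_deriv_eq_zero hAc.isPreconnected
      (fun t ht => (hgd t ht).differentiableAt.differentiableWithinAt)
      (fun t ht => (hgd t ht).deriv) (show s ∈ A from hs) h0
    simpa [f, c, hdL, Pi.add_def] using this
  let T : ((Fin n → ℝ) × ℝ) →ₗ[ℝ] (Fin m → ℝ) :=
    { toFun := fun w => (fun j => dot w.1 (N j)) + fun _ => w.2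
      map_add' := fun x y => by
        ext j; simp only [Prod.fst_add, Prod.snd_add, Pi.add_apply, dot_add_l]; ring
      map_smul' := fun t x => by
        ext j; simp only [Prod.smul_fst, Prod.smul_snd, Pi.add_apply, Pi.smul_apply, dot_smul_l,
          smul_eq_mul, RingHom.id_apply]; ring }
  have hTd : ∀ w, T w = (fun j => dot w.1 (N j)) + fun _ => w.2 := fun w => rfl
  have hrec : ∀ a : Fin n → ℝ, (∀ j, dot a (N j) ≤ 0) → a = 0 := by
    intro a ha
    obtain ⟨e, he, l, hl, hc⟩ := hcov a
    have h1 : dot a a ≤ 0 := by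
      conv_lhs => rw [hc, ← hc, hc]
      have : dot a (∑ i, l i • N (e i)) ≤ 0 := by
        rw [dot_sum_r]
        refine Finset.sum_nonpos fun i _ => ?_
        rw [dot_smul_r]
        exact mul_nonpos_of_nonneg_of_nonpos (hl i) (ha _)
      rwa [← hc] at this ⊢
    have h2 : a ⬝ᵥ a = 0 := le_antisymm h1 (Finset.sum_nonneg fun i _ => mul_self_nonneg _)
    exact dotProduct_self_eq_zero.1 h2
  have hTi : Function.Injective T := by
    rw [← LinearMap.ker_eq_bot, LinearMap.ker_eq_bot']
    rintro ⟨a, s⟩ h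
    have h1 : ∀ j, dot a (N j) + s = 0 := fun j => congrFun h j
    have ha : a = 0 := by
      rcases le_total 0 s with hs | hs
      · exact hrec a fun j => by linarith [h1 j]
      · have := hrec ((-1:ℝ) • a) fun j => by rw [dot_smul_l]; linarith [h1 j]
        simpa using this
    have h2 := h1 ⟨0, hm⟩
    rw [ha, dot_zero_l, zero_add] at h2
    rw [ha, h2]; rfl
  obtain ⟨L, hL⟩ := abs_lin (n := n) (UU N k0) hUo (UU_add N k0) (UU_smul N k0) k0 hk0 T hTi hm2
    (dL.toLinearMap ∘ₗ LinearMap.fst ℝ _ _) f hfd (by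
      intro k hk w hw
      have h1 := UU_translate N k0 k w.1 hk
      rw [hTd, ← add_assoc] at hw ⊢
      rw [hone _ h1 w.2 hw, htr k hk]
      rfl) hom
  refine ⟨fun j => L (Pi.single j 1), 0, fun k hk => ?_⟩
  rw [hch] at hk
  have := hL k hk
  rw [add_zero]
  refine this.trans ?_
  rw [LinearMap.pi_apply_eq_sum_univ L k]
  refine Finset.sum_congr rfl fun j _ => ?_
  rw [smul_eq_mul, mul_comm]
  congr 2
  ext i
  simp [Pi.single_apply, eq_comm]
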